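/- arXiv:1411.4740 — 2 statements merged into one kernel-verified Lean document; each statement's English description precedes it below -/
import Mathlib

section
/- For every t ∈ {0, 1, 2, …}, E[e^{r Z(t)}] ≤ D + (e^{r z₀} − D) ρ^t, where D = (e^{r δ_max} − ρ) e^{r θ}/(1 − ρ). -/
open MeasureTheory

/-- A Bernstein-type bound on the exponential of a bounded variable. -/
lemma exp_le_one_add_add_of_abs_le {u c : ℝ} (hu : |u| ≤ c) (hc : c ≤ 1) :
    Real.exp u ≤ 1 + u + c ^ 2 / 2 / (1 - c / 3) := by
  have hc0 : 0 ≤ c := (abs_nonneg u).trans hu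
  have h := (abs_le.1 (Real.exp_bound (hu.trans hc) (n := 4) (by norm_num))).2
  norm_num [Finset.sum_range_succ, Nat.factorial] at h
  have h2 : u ^ 2 ≤ c ^ 2 := sq_abs u ▸ pow_le_pow_left₀ (abs_nonneg u) hu 2
  have h3 : u ^ 3 ≤ c ^ 3 :=
    (le_abs_self _).trans (abs_pow u 3 ▸ pow_le_pow_left₀ (abs_nonneg u) hu 3)
  have h4 : |u| ^ 4 ≤ c ^ 4 := pow_le_pow_left₀ (abs_nonneg u) hu 4
  have h5 : c ^ 2 / 2 + c ^ 3 / 6 + c ^ 4 / 18 ≤ c ^ 2 / 2 / (1 - c / 3) := by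
    rw [le_div_iff₀ (by linarith)]
    nlinarith [pow_nonneg hc0 5]
  have h6 : 0 ≤ c ^ 4 := by positivity
  linarith

/-- If `Y` has nonpositive conditional expectation wherever the nonnegative `m`-measurable weight
`G` does not vanish, then `G * Y` has nonpositive expectation. -/
lemma integral_mul_nonpos_of_condExp_nonpos {Ω : Type*} {m m0 : MeasurableSpace Ω}
    {P : Measure Ω} [IsFiniteMeasure P] (hm : m ≤ m0) {G Y : Ω → ℝ}
    (hG : StronglyMeasurable[m] G) (hGY : Integrable (fun x => G x * Y x) P)
    (hY : Integrable Y P) (h : ∀ᵐ x ∂P, G x * (P[Y | m]) x ≤ 0) :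
    ∫ x, G x * Y x ∂P ≤ 0 := by
  rw [← integral_condExp hm]
  refine integral_nonpos_of_ae ?_
  filter_upwards [condExp_mul_of_stronglyMeasurable_left hG hGY hY, h] with x hx hneg
  exact hx.le.trans hneg

/-- One step of the drift argument. -/
lemma integral_exp_le_of_drift {Ω : Type*} {m m0 : MeasurableSpace Ω}
    {P : Measure Ω} [IsProbabilityMeasure P] (hm : m ≤ m0) {X Y : Ω → ℝ}
    {r δ β θ ρ K : ℝ} (hr : 0 < r) (hρδ : ρ ≤ Real.exp (r * δ))
    (hρ : ρ = 1 - r * β / 2) (hX : Measurable[m] X) (hY : Measurable Y)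
    (hXK : ∀ᵐ x ∂P, |X x| ≤ K) (hYX : ∀ᵐ x ∂P, |Y x - X x| ≤ δ)
    (hexp : ∀ u, |u| ≤ δ → Real.exp (r * u) ≤ 1 + r * u + r * β / 2)
    (hdrift : ∀ᵐ x ∂P, θ ≤ X x → (P[fun y => Y y - X y | m]) x ≤ -β) :
    ∫ x, Real.exp (r * Y x) ∂P ≤
      ρ * ∫ x, Real.exp (r * X x) ∂P + (Real.exp (r * δ) - ρ) * Real.exp (r * θ) := by
  have hX0 : Measurable X := hX.mono hm le_rfl
  have hiX : Integrable (fun x => Real.exp (r * X x)) P := by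
    refine Integrable.of_bound (by fun_prop) (Real.exp (r * K)) ?_
    filter_upwards [hXK] with x hx
    rw [Real.norm_eq_abs, Real.abs_exp]
    gcongr
    exact (abs_le.1 hx).2
  have hiΔ : Integrable (fun x => Y x - X x) P :=
    Integrable.of_bound (by fun_prop) δ hYX
  have hiΔβ : Integrable (fun x => Y x - X x + β) P := hiΔ.add (integrable_const β)
  have hiY : Integrable (fun x => Real.exp (r * Y x)) P := by
    refine Integrable.of_bound (by fun_prop) (Real.exp (r * (K + δ))) ?_
    filter_upwards [hXK, hYX] with x hx hy
    rw [Real.norm_eq_abs, Real.abs_exp]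
    gcongr
    linarith [(abs_le.1 hx).2, (abs_le.1 hy).2]
  set G : Ω → ℝ := {x | θ ≤ X x}.indicator fun x => Real.exp (r * X x) with hGdef
  have hGm : Measurable[m] G :=
    (Real.measurable_exp.comp (hX.const_mul r)).indicator (measurableSet_le measurable_const hX)
  have hiG : Integrable (fun x => G x * (Y x - X x + β)) P := by
    refine hiΔβ.bdd_mul (c := Real.exp (r * K)) (hGm.mono hm le_rfl).aestronglyMeasurable ?_
    filter_upwards [hXK] with x hx
    refine (norm_indicator_le_norm_self _ x).trans ?_
    rw [Real.norm_eq_abs, Real.abs_exp]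
    gcongr
    exact (abs_le.1 hx).2
  have hneg : ∫ x, G x * (Y x - X x + β) ∂P ≤ 0 := by
    refine integral_mul_nonpos_of_condExp_nonpos hm hGm.stronglyMeasurable hiG hiΔβ ?_
    filter_upwards [hdrift, condExp_add hiΔ (integrable_const β) m] with x hx hadd
    by_cases hθ : θ ≤ X x
    · refine mul_nonpos_of_nonneg_of_nonpos
        (Set.indicator_nonneg (fun _ _ => (Real.exp_pos _).le) x) (hadd.le.trans ?_)
      rw [Pi.add_apply, condExp_const hm]
      linarith [hx hθ]
    · simp [hGdef, hθ]
  have hpt : ∀ᵐ x ∂P, Real.exp (r * Y x) ≤ ρ * Real.exp (r * X x)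
      + (Real.exp (r * δ) - ρ) * Real.exp (r * θ) + r * (G x * (Y x - X x + β)) := by
    filter_upwards [hYX] with x hx
    have hsplit : Real.exp (r * Y x) = Real.exp (r * X x) * Real.exp (r * (Y x - X x)) := by
      rw [← Real.exp_add]; ring_nf
    have hpos := Real.exp_pos (r * X x)
    rw [hsplit]
    by_cases hθ : θ ≤ X x
    · have hG : G x = Real.exp (r * X x) := by simp [hGdef, hθ]
      have h := mul_le_mul_of_nonneg_left (hexp _ hx) hpos.le
      have := mul_nonneg (sub_nonneg.2 hρδ) (Real.exp_pos (r * θ)).le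
      rw [hG]
      rw [hρ] at this ⊢
      linarith
    · have hG : G x = 0 := by simp [hGdef, hθ]
      have h1 : Real.exp (r * (Y x - X x)) ≤ Real.exp (r * δ) := by
        gcongr
        exact (abs_le.1 hx).2
      have h2 : Real.exp (r * X x) ≤ Real.exp (r * θ) := by
        gcongr
        exact (not_le.1 hθ).le
      have h3 := mul_le_mul_of_nonneg_left h1 hpos.le
      have h4 := mul_le_mul_of_nonneg_left h2 (sub_nonneg.2 hρδ)
      rw [hG]
      linarith
  have hiρ := hiX.const_mul ρ
  have hic : Integrable (fun _ : Ω => (Real.exp (r * δ) - ρ) * Real.exp (r * θ)) P :=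
    integrable_const _
  have hint := integral_mono_ae hiY ((hiρ.add hic).add (hiG.const_mul r)) hpt
  rw [integral_add' (hiρ.add hic) (hiG.const_mul r), integral_add' hiρ hic,
    integral_const_mul ρ, integral_const_mul r, integral_const, probReal_univ, one_smul] at hint
  linarith [mul_nonpos_of_nonneg_of_nonpos hr.le hneg]

/-- Under the drift assumptions (increments bounded by `δmax`,
conditional drift at most `−β` on `{Z(t) ≥ θ}`, `Z(0) = z₀` a.s., `0 < β ≤ δmax`),
with `r = β/(δmax² + δmax β/3)`, `ρ = 1 − rβ/2`, and
`D = (e^{r δmax} − ρ) e^{r θ}/(1 − ρ)`, one has for every `t`: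
`E[e^{r Z(t)}] ≤ D + (e^{r z₀} − D) ρ^t`. -/
theorem stmt3 {Ωs : Type*} [MeasurableSpace Ωs] (P : Measure Ωs) [IsProbabilityMeasure P]
    (Z : ℕ → Ωs → ℝ) (z0 θ δmax β r ρ D : ℝ)
    (hmeas : ∀ t, Measurable (Z t))
    (hZ0 : ∀ᵐ x ∂P, Z 0 x = z0)
    (hδ : 0 < δmax) (hβ : 0 < β) (hβδ : β ≤ δmax)
    (hbdd : ∀ t : ℕ, ∀ᵐ x ∂P, |Z (t + 1) x - Z t x| ≤ δmax)
    (hdrift : ∀ t : ℕ, ∀ᵐ x ∂P, θ ≤ Z t x →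
      (P[fun y => Z (t + 1) y - Z t y |
        ⨆ i ∈ Finset.range (t + 1), MeasurableSpace.comap (Z i) inferInstance]) x ≤ -β)
    (hr : r = β / (δmax ^ 2 + δmax * β / 3)) (hρ : ρ = 1 - r * β / 2)
    (hD : D = (Real.exp (r * δmax) - ρ) * Real.exp (r * θ) / (1 - ρ)) :
    ∀ t : ℕ, ∫ x, Real.exp (r * Z t x) ∂P ≤ D + (Real.exp (r * z0) - D) * ρ ^ t := by
  have hden : 0 < δmax ^ 2 + δmax * β / 3 := by positivity
  have hr0 : 0 < r := hr ▸ div_pos hβ hden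
  have hrden : r * (δmax ^ 2 + δmax * β / 3) = β := by rw [hr]; field_simp
  have hrδ : r * δmax ≤ 1 := by
    rw [hr, div_mul_eq_mul_div, div_le_one hden]
    nlinarith
  have hrβ : r * β ≤ 1 := (mul_le_mul_of_nonneg_left hβδ hr0.le).trans hrδ
  have hrβ0 : 0 < r * β := mul_pos hr0 hβ
  have hρ1 : ρ < 1 := by linarith
  have hρ0 : 0 ≤ ρ := by linarith
  have hD' : (Real.exp (r * δmax) - ρ) * Real.exp (r * θ) = D * (1 - ρ) := by
    rw [hD, div_mul_cancel₀ _ (by linarith)]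
  have hρδ : ρ ≤ Real.exp (r * δmax) := hρ1.le.trans (Real.one_le_exp (by positivity))
  have hexp (u : ℝ) (hu : |u| ≤ δmax) : Real.exp (r * u) ≤ 1 + r * u + r * β / 2 := by
    have hru : |r * u| ≤ r * δmax := by
      rw [abs_mul, abs_of_pos hr0]
      gcongr
    refine (exp_le_one_add_add_of_abs_le hru hrδ).trans_eq ?_
    congr 1
    rw [div_eq_iff (by linarith)]
    linear_combination (r / 2) * hrden
  have hbound (t : ℕ) : ∀ᵐ x ∂P, |Z t x| ≤ |z0| + t * δmax := by
    induction t with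
    | zero => filter_upwards [hZ0] with x hx using by simp [hx]
    | succ t ih =>
      filter_upwards [ih, hbdd t] with x hx hx'
      push_cast
      linarith [abs_sub_abs_le_abs_sub (Z (t + 1) x) (Z t x)]
  intro t
  induction t with
  | zero =>
    have h0 : (fun x => Real.exp (r * Z 0 x)) =ᵐ[P] fun _ => Real.exp (r * z0) := by
      filter_upwards [hZ0] with x hx using by rw [hx]
    simp [integral_congr_ae h0]
  | succ t ih =>
    have hm : (⨆ i ∈ Finset.range (t + 1),
        MeasurableSpace.comap (Z i) inferInstance) ≤ ‹MeasurableSpace Ωs› :=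
      iSup₂_le fun i _ => (hmeas i).comap_le
    have hZt : Measurable[⨆ i ∈ Finset.range (t + 1),
        MeasurableSpace.comap (Z i) inferInstance] (Z t) :=
      (comap_measurable (Z t)).mono
        (le_iSup₂_of_le t (Finset.self_mem_range_succ t) le_rfl) le_rfl
    refine (integral_exp_le_of_drift hm hr0 hρδ hρ hZt (hmeas (t + 1)) (hbound t) (hbdd t)
      hexp (hdrift t)).trans ?_
    rw [hD', pow_succ]
    linarith [mul_le_mul_of_nonneg_left ih hρ0]
end

section
/- For any real c > 0 and any integers T, t with 0 ≤ T < t, the expected fraction of time that Z exceeds θ + c satisfies (1/t) Σ_{τ=0}^{t−1} P[Z(τ) ≥ θ + c] ≤ (e^{r δ_max} − ρ) e^{−rc}/(1 − ρ) + T/t + e^{r(z₀ − c − θ)} ρ^T / (t(1 − ρ)). -/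
open MeasureTheory

/-- Bernstein's bound on the exponential near `0`, for a radius at most `1`. -/
theorem exp_le_one_add_add_sq_div {u a : ℝ} (hu : |u| ≤ a) (ha : a ≤ 1) :
    Real.exp u ≤ 1 + u + a ^ 2 / 2 / (1 - a / 3) := by
  have h0 : 0 ≤ |u| := abs_nonneg u
  have hb := (abs_le.1 (Real.exp_bound (hu.trans ha) (n := 4) (by norm_num))).2
  simp only [Finset.sum_range_succ, Finset.sum_range_zero, Nat.factorial] at hb
  norm_num at hb
  have h2 : u ^ 2 ≤ a ^ 2 := by rw [← sq_abs u]; gcongr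
  have h3 : u ^ 3 ≤ a ^ 3 :=
    (le_abs_self _).trans (by rw [abs_pow]; gcongr)
  have h4 : |u| ^ 4 ≤ a ^ 4 := by gcongr
  have h4' : u ^ 4 ≤ a ^ 4 := (le_abs_self _).trans (by rw [abs_pow]; exact h4)
  have key : a ^ 2 / 2 + a ^ 3 / 6 + a ^ 4 * (5 / 96) ≤ a ^ 2 / 2 / (1 - a / 3) := by
    have ha0 : 0 ≤ a := h0.trans hu
    rw [le_div_iff₀ (by linarith)]
    have : 0 ≤ a ^ 4 := by positivity
    have : 0 ≤ a ^ 5 := by positivity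
    nlinarith
  linarith

/-- With `r = β / (δ² + δ β / 3)`, the exponential `exp (r x)` of a step of size at most `δ` lies
below an affine function of `x` that takes the value `1 - r β / 2` at `x = -β`. -/
theorem exp_mul_step_le {δ β r x : ℝ} (hδ : 0 < δ) (hβ : 0 < β) (hβδ : β ≤ δ)
    (hr : r = β / (δ ^ 2 + δ * β / 3)) (hx : |x| ≤ δ) :
    Real.exp (r * x) ≤ 1 + r * x + r * β / 2 := by
  have hr0 : 0 < r := by rw [hr]; positivity
  have hrδ : r * δ = 3 * β / (3 * δ + β) := by rw [hr]; field_simp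
  have hle : r * δ ≤ 1 := by
    rw [hrδ, div_le_one (by positivity)]; linarith
  have h := exp_le_one_add_add_sq_div (u := r * x) (a := r * δ)
    (by rw [abs_mul, abs_of_pos hr0]; gcongr) hle
  have heq : (r * δ) ^ 2 / 2 / (1 - r * δ / 3) = r * β / 2 := by
    have h1 : 1 - r * δ / 3 = 3 * δ / (3 * δ + β) := by rw [hrδ]; field_simp; ring
    rw [h1, mul_pow, hr]; field_simp
  linarith

theorem ae_abs_sub_le_of_ae_abs_step_le {Ω : Type*} [MeasurableSpace Ω] {P : Measure Ω}
    {Z : ℕ → Ω → ℝ} {z δ : ℝ} (h0 : ∀ᵐ x ∂P, Z 0 x = z)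
    (hstep : ∀ t : ℕ, ∀ᵐ x ∂P, |Z (t + 1) x - Z t x| ≤ δ) (t : ℕ) :
    ∀ᵐ x ∂P, |Z t x - z| ≤ t * δ := by
  induction t with
  | zero => filter_upwards [h0] with x hx; simp [hx]
  | succ t ih =>
    filter_upwards [ih, hstep t] with x h1 h2
    have := abs_sub_le (Z (t + 1) x) (Z t x) z
    push_cast
    linarith

theorem integrable_exp_mul_of_ae_abs_sub_le {Ω : Type*} [MeasurableSpace Ω] {P : Measure Ω}
    [IsFiniteMeasure P] {X : Ω → ℝ} (hX : Measurable X) {r z C : ℝ} (hr : 0 ≤ r)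
    (h : ∀ᵐ x ∂P, |X x - z| ≤ C) : Integrable (fun x => Real.exp (r * X x)) P := by
  refine Integrable.of_bound (by fun_prop) (Real.exp (r * (z + C))) ?_
  filter_upwards [h] with x hx
  rw [Real.norm_eq_abs, Real.abs_exp]
  have := (abs_le.1 hx).2
  gcongr
  linarith

/-- If the conditional expectation of `X` is at most `b` where the conditioning-measurable weight
`W ≥ 0` is nonzero, then `∫ W X ≤ b ∫ W`. -/
theorem integral_mul_le_of_condExp_le {Ω : Type*} {m m0 : MeasurableSpace Ω} {P : Measure Ω}
    [IsFiniteMeasure P] (hm : m ≤ m0) {W X : Ω → ℝ} {b : ℝ} (hW : StronglyMeasurable[m] W)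
    (hW0 : ∀ x, 0 ≤ W x) (hWi : Integrable W P) (hX : Integrable X P)
    (hWX : Integrable (W * X) P) (h : ∀ᵐ x ∂P, W x ≠ 0 → (P[X | m]) x ≤ b) :
    ∫ x, W x * X x ∂P ≤ b * ∫ x, W x ∂P := by
  have hpull : P[W * X | m] =ᵐ[P] W * P[X | m] :=
    condExp_mul_of_stronglyMeasurable_left hW hWX hX
  calc ∫ x, W x * X x ∂P = ∫ x, (P[W * X | m]) x ∂P := (integral_condExp hm).symm
    _ ≤ ∫ x, b * W x ∂P := by
        refine integral_mono_ae integrable_condExp (hWi.const_mul b) ?_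
        filter_upwards [hpull, h] with x h1 h2
        rw [h1, Pi.mul_apply, mul_comm b]
        by_cases hx : W x = 0
        · simp [hx]
        · exact mul_le_mul_of_nonneg_left (h2 hx) (hW0 x)
    _ = b * ∫ x, W x ∂P := integral_const_mul b W

/-- One-step contraction of the exponential moment under a negative drift above `θ`. -/
theorem integral_exp_mul_le_of_drift {Ω : Type*} {m m0 : MeasurableSpace Ω} {P : Measure Ω}
    [IsProbabilityMeasure P] (hm : m ≤ m0) {X Y : Ω → ℝ} {θ δ β r : ℝ}
    (hXm : Measurable[m] X) (hY : Measurable Y)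
    (hδ : 0 < δ) (hβ : 0 < β) (hβδ : β ≤ δ) (hr : r = β / (δ ^ 2 + δ * β / 3))
    (hbdd : ∀ᵐ x ∂P, |Y x - X x| ≤ δ)
    (hdrift : ∀ᵐ x ∂P, θ ≤ X x → (P[fun y => Y y - X y | m]) x ≤ -β)
    (hXi : Integrable (fun x => Real.exp (r * X x)) P)
    (hYi : Integrable (fun x => Real.exp (r * Y x)) P) :
    ∫ x, Real.exp (r * Y x) ∂P ≤ (1 - r * β / 2) * ∫ x, Real.exp (r * X x) ∂P +
      (Real.exp (r * δ) - (1 - r * β / 2)) * Real.exp (r * θ) := by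
  have hr0 : 0 < r := by rw [hr]; positivity
  set ρ := 1 - r * β / 2 with hρ
  have hρ1 : ρ ≤ Real.exp (r * δ) := by
    have := Real.one_le_exp (x := r * δ) (by positivity)
    have : 0 < r * β := by positivity
    linarith
  have hX : Measurable X := hXm.mono hm le_rfl
  let W : Ω → ℝ := {x | θ ≤ X x}.indicator fun x => Real.exp (r * X x)
  have hS : MeasurableSet[m] {x | θ ≤ X x} := measurableSet_le measurable_const hXm
  have hWm : Measurable[m] W :=
    (Real.measurable_exp.comp (hXm.const_mul r)).indicator hS
  have hW0 (x : Ω) : 0 ≤ W x := Set.indicator_nonneg (fun _ _ => (Real.exp_pos _).le) x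
  have hWi : Integrable W P := hXi.indicator (hm _ hS)
  have hD : Integrable (fun x => Y x - X x) P :=
    Integrable.of_bound (by fun_prop) δ hbdd
  have hWD : Integrable (fun x => W x * (Y x - X x)) P :=
    hWi.mul_bdd (c := δ) (by fun_prop) hbdd
  have hint : ∫ x, W x * (Y x - X x) ∂P ≤ -β * ∫ x, W x ∂P := by
    refine integral_mul_le_of_condExp_le hm hWm.stronglyMeasurable hW0 hWi hD hWD ?_
    filter_upwards [hdrift] with x hx hWx
    exact hx (Set.mem_of_indicator_ne_zero (s := {x | θ ≤ X x}) hWx)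
  have hpt : ∀ᵐ x ∂P, Real.exp (r * Y x) ≤ ρ * Real.exp (r * X x) +
      (Real.exp (r * δ) - ρ) * Real.exp (r * θ) + (r * (W x * (Y x - X x)) + r * β * W x) := by
    filter_upwards [hbdd] with x hx
    have hsplit : Real.exp (r * Y x) = Real.exp (r * X x) * Real.exp (r * (Y x - X x)) := by
      rw [← Real.exp_add]; ring_nf
    by_cases hθ : θ ≤ X x
    · have hWx : W x = Real.exp (r * X x) := Set.indicator_of_mem (s := {x | θ ≤ X x}) hθ _
      have h1 := mul_le_mul_of_nonneg_left (exp_mul_step_le hδ hβ hβδ hr hx)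
        (Real.exp_pos (r * X x)).le
      have h2 := mul_nonneg (sub_nonneg.2 hρ1) (Real.exp_pos (r * θ)).le
      rw [hWx, hsplit]
      rw [hρ] at h2 ⊢
      linarith
    · have hWx : W x = 0 := Set.indicator_of_notMem (s := {x | θ ≤ X x}) hθ _
      have h1 : Real.exp (r * (Y x - X x)) ≤ Real.exp (r * δ) := by
        have := (abs_le.1 hx).2
        gcongr
      have h2 : Real.exp (r * X x) ≤ Real.exp (r * θ) := by
        have := (not_le.1 hθ).le
        gcongr
      have h3 := mul_le_mul_of_nonneg_left h1 (Real.exp_pos (r * X x)).le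
      have h4 := mul_le_mul_of_nonneg_left h2 (sub_nonneg.2 hρ1)
      rw [hWx, hsplit]
      linarith
  have hi₁ : Integrable (fun x => ρ * Real.exp (r * X x) +
      (Real.exp (r * δ) - ρ) * Real.exp (r * θ)) P :=
    (hXi.const_mul ρ).add (integrable_const _)
  have hi₂ : Integrable (fun x => r * (W x * (Y x - X x)) + r * β * W x) P :=
    (hWD.const_mul r).add (hWi.const_mul _)
  have h := integral_mono_ae hYi (hi₁.add hi₂) hpt
  simp only [Pi.add_apply] at h
  rw [integral_add hi₁ hi₂, integral_add (hXi.const_mul ρ) (integrable_const _),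
    integral_add (hWD.const_mul r) (hWi.const_mul _)] at h
  simp only [integral_const_mul, integral_const, probReal_univ, one_smul] at h
  have := mul_le_mul_of_nonneg_left hint hr0.le
  linarith

/-- Solution of the affine recursive inequality `a (n + 1) ≤ ρ a n + K`. -/
theorem le_pow_mul_add_div_of_affine_rec {a : ℕ → ℝ} {ρ K : ℝ} (hρ0 : 0 ≤ ρ) (hρ1 : ρ < 1)
    (hK : 0 ≤ K) (h : ∀ n, a (n + 1) ≤ ρ * a n + K) (n : ℕ) :
    a n ≤ ρ ^ n * a 0 + K / (1 - ρ) := by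
  have h1 : 0 < 1 - ρ := sub_pos.2 hρ1
  induction n with
  | zero => simpa using div_nonneg hK h1.le
  | succ n ih =>
    have h2 := mul_le_mul_of_nonneg_left ih hρ0
    have h3 : ρ * (K / (1 - ρ)) + K = K / (1 - ρ) := by field_simp; ring
    rw [pow_succ]
    linarith [h n]

/-- Averaging bound for a sequence in `[0, 1]` dominated by a constant plus a geometric term. -/
theorem average_le_of_le_geometric {p : ℕ → ℝ} {A B ρ : ℝ} (hA : 0 ≤ A) (hB : 0 ≤ B)
    (hρ0 : 0 ≤ ρ) (hρ1 : ρ < 1) (hp1 : ∀ n, p n ≤ 1) (hp : ∀ n, p n ≤ A + B * ρ ^ n)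
    {T t : ℕ} (hT : T < t) :
    (1 / (t : ℝ)) * ∑ τ ∈ Finset.range t, p τ ≤
      A + (T : ℝ) / t + B * ρ ^ T / (t * (1 - ρ)) := by
  have h1 : 0 < 1 - ρ := sub_pos.2 hρ1
  have ht : (0 : ℝ) < t := by exact_mod_cast (Nat.zero_le T).trans_lt hT
  have hhead : ∑ τ ∈ Finset.range T, p τ ≤ T := by
    simpa using Finset.sum_le_sum fun τ (_ : τ ∈ Finset.range T) => hp1 τ
  have htail : ∑ τ ∈ Finset.Ico T t, p τ ≤ t * A + B * (ρ ^ T / (1 - ρ)) := by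
    calc ∑ τ ∈ Finset.Ico T t, p τ ≤ ∑ τ ∈ Finset.Ico T t, (A + B * ρ ^ τ) :=
          Finset.sum_le_sum fun τ _ => hp τ
      _ = ((t - T : ℕ) : ℝ) * A + B * ∑ τ ∈ Finset.Ico T t, ρ ^ τ := by
          rw [Finset.sum_add_distrib, ← Finset.mul_sum]; simp
      _ ≤ t * A + B * (ρ ^ T / (1 - ρ)) := by
          gcongr
          · exact Nat.sub_le t T
          · exact geom_sum_Ico_le_of_lt_one hρ0 hρ1
  rw [← Finset.sum_range_add_sum_Ico _ hT.le, one_div, inv_mul_le_iff₀ ht]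
  calc _ ≤ (T : ℝ) + (t * A + B * (ρ ^ T / (1 - ρ))) := add_le_add hhead htail
    _ = _ := by field_simp; ring

/-- Under the drift assumptions, for any real `c > 0` and integers
`0 ≤ T < t`, the expected fraction of time that `Z` exceeds `θ + c` satisfies
`(1/t) Σ_{τ=0}^{t−1} P[Z(τ) ≥ θ + c]
  ≤ (e^{r δmax} − ρ) e^{−rc}/(1 − ρ) + T/t + e^{r(z₀ − c − θ)} ρ^T / (t(1 − ρ))`. -/
theorem stmt4 {Ωs : Type*} [MeasurableSpace Ωs] (P : Measure Ωs) [IsProbabilityMeasure P]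
    (Z : ℕ → Ωs → ℝ) (z0 θ δmax β r ρ : ℝ)
    (hmeas : ∀ t, Measurable (Z t))
    (hZ0 : ∀ᵐ x ∂P, Z 0 x = z0)
    (hδ : 0 < δmax) (hβ : 0 < β) (hβδ : β ≤ δmax)
    (hbdd : ∀ t : ℕ, ∀ᵐ x ∂P, |Z (t + 1) x - Z t x| ≤ δmax)
    (hdrift : ∀ t : ℕ, ∀ᵐ x ∂P, θ ≤ Z t x →
      (P[fun y => Z (t + 1) y - Z t y |
        ⨆ i ∈ Finset.range (t + 1), MeasurableSpace.comap (Z i) inferInstance]) x ≤ -β)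
    (hr : r = β / (δmax ^ 2 + δmax * β / 3)) (hρ : ρ = 1 - r * β / 2) :
    ∀ c : ℝ, 0 < c → ∀ T t : ℕ, T < t →
      (1 / (t : ℝ)) * ∑ τ ∈ Finset.range t, (P {x | θ + c ≤ Z τ x}).toReal ≤
        (Real.exp (r * δmax) - ρ) * Real.exp (-(r * c)) / (1 - ρ) + (T : ℝ) / t +
          Real.exp (r * (z0 - c - θ)) * ρ ^ T / (t * (1 - ρ)) := by
  intro c _ T t hT
  have hr0 : 0 < r := by rw [hr]; positivity
  have hrβ : r * β ≤ 1 := by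
    rw [hr, div_mul_eq_mul_div, div_le_one (by positivity)]
    nlinarith [mul_pos hδ hβ]
  have hρ0 : 0 ≤ ρ := by linarith
  have hρ1 : ρ < 1 := by linarith [mul_pos hr0 hβ]
  have hK : 0 ≤ Real.exp (r * δmax) - ρ := by
    have := Real.one_le_exp (x := r * δmax) (by positivity)
    linarith
  have hint (n : ℕ) : Integrable (fun x => Real.exp (r * Z n x)) P :=
    integrable_exp_mul_of_ae_abs_sub_le (hmeas n) hr0.le
      (ae_abs_sub_le_of_ae_abs_step_le hZ0 hbdd n)
  have hrec (n : ℕ) : ∫ x, Real.exp (r * Z (n + 1) x) ∂P ≤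
      ρ * ∫ x, Real.exp (r * Z n x) ∂P + (Real.exp (r * δmax) - ρ) * Real.exp (r * θ) := by
    rw [hρ]
    refine integral_exp_mul_le_of_drift (iSup₂_le fun i _ => (hmeas i).comap_le) ?_
      (hmeas (n + 1)) hδ hβ hβδ hr (hbdd n) (hdrift n) (hint n) (hint (n + 1))
    exact (comap_measurable (Z n)).mono
      (le_iSup₂_of_le n (Finset.self_mem_range_succ n) le_rfl) le_rfl
  have hzero : ∫ x, Real.exp (r * Z 0 x) ∂P = Real.exp (r * z0) := by
    have : (fun x => Real.exp (r * Z 0 x)) =ᵐ[P] fun _ => Real.exp (r * z0) := by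
      filter_upwards [hZ0] with x hx
      rw [hx]
    simp [integral_congr_ae this]
  refine average_le_of_le_geometric (by have := sub_pos.2 hρ1; positivity)
    (Real.exp_pos _).le hρ0 hρ1 (fun _ => measureReal_le_one) (fun n => ?_) hT
  have hmom := le_pow_mul_add_div_of_affine_rec (a := fun n => ∫ x, Real.exp (r * Z n x) ∂P)
    hρ0 hρ1 (by positivity) hrec n
  have hchernoff := ProbabilityTheory.measure_ge_le_exp_mul_mgf (X := Z n) (θ + c) hr0.le (hint n)
  refine hchernoff.trans ((mul_le_mul_of_nonneg_left hmom (Real.exp_pos _).le).trans_eq ?_)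
  simp only [hzero]
  rw [show r * (z0 - c - θ) = -r * (θ + c) + r * z0 by ring, Real.exp_add,
    show -(r * c) = -r * (θ + c) + r * θ by ring, Real.exp_add]
  ring
end
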